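/- Let q > 1 and let χ be a primitive, real, even Dirichlet character of conductor q (i.e. χ is primitive, χ(-1) = 1, and all values of χ are real). Then for every integer n ≥ 1, every real t, and every integer x: (τ(χ)/(qn)) · ∑_{ω=1}^{qn−1} χ(ω)·e^{−4t sin²(πω/(qn))}·e^{2πi·xω/(qn)} = ∑_{j=1}^{q−1} χ(j)·K_n(t, x − jn), where τ(χ) := ∑_{j=1}^{q} χ(j)·e^{2πij/q} is the Gauss sum and K_n(t,x) := (1/(qn))·∑_{j=0}^{qn−1} e^{−4t sin²(πj/(qn))}·e^{2πi·xj/(qn)}. In particular, taking x = 0, τ(χ)·∑_{j=1}^{qn−1} χ(j)·e^{−4t sin²(πj/(qn))} = qn·∑_{j=1}^{q−1} χ(j)·K_n(t, jn). -/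

import Mathlib

open Finset

/-- The heat kernel of the combinatorial Laplacian on the cycle graph `ℤ/(qn)ℤ`:
`K_n(t,x) = (1/(qn))·∑_{j=0}^{qn−1} e^{−4t sin²(πj/(qn))}·e^{2πi·xj/(qn)}`. -/
noncomputable def heatKernel (q n : ℕ) (t : ℝ) (x : ℤ) : ℂ :=
  (1 / (q * n : ℂ)) * ∑ j ∈ Finset.range (q * n),
    (Real.exp (-(4 * t * Real.sin (Real.pi * j / (q * n)) ^ 2)) : ℂ) *
      Complex.exp (2 * Real.pi * Complex.I * x * j / (q * n))

/-- The Gauss sum `τ(χ) = ∑_{j=1}^{q} χ(j)·e^{2πij/q}`. -/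
noncomputable def gaussSum' {q : ℕ} (χ : DirichletCharacter ℂ q) : ℂ :=
  ∑ j ∈ Finset.Icc 1 q, χ (j : ZMod q) * Complex.exp (2 * Real.pi * Complex.I * j / q)

theorem ZMod.sum_range_natCast {M : Type*} [AddCommMonoid M] {q : ℕ} [NeZero q]
    (f : ZMod q → M) : ∑ j ∈ Finset.range q, f (j : ZMod q) = ∑ a : ZMod q, f a := by
  refine Finset.sum_nbij' (fun j => (j : ZMod q)) ZMod.val ?_ ?_ ?_ ?_ ?_
  · simp
  · intro a _
    simpa using ZMod.val_lt a
  · intro j hj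
    exact ZMod.val_cast_of_lt (Finset.mem_range.mp hj)
  · simp
  · simp

theorem DirichletCharacter.inv_eq_self_of_im_eq_zero {q : ℕ} [NeZero q]
    {χ : DirichletCharacter ℂ q} (hreal : ∀ x : ZMod q, (χ x).im = 0) : χ⁻¹ = χ := by
  ext a
  rw [← MulChar.star_eq_inv, MulChar.star_apply]
  exact Complex.conj_eq_iff_im.mpr (hreal a)

theorem DirichletCharacter.apply_zero_of_one_lt {q : ℕ} (hq : 1 < q)
    (χ : DirichletCharacter ℂ q) : χ 0 = 0 := by
  have : Fact (1 < q) := ⟨hq⟩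
  exact χ.map_nonunit not_isUnit_zero

theorem gaussSum'_eq_gaussSum {q : ℕ} (hq : 1 < q) [NeZero q] (χ : DirichletCharacter ℂ q) :
    gaussSum' χ = gaussSum χ ZMod.stdAddChar := by
  have h0 : χ (0 : ZMod q) = 0 := χ.apply_zero_of_one_lt hq
  rw [gaussSum, ← ZMod.sum_range_natCast, Finset.range_eq_Ico,
    Finset.sum_eq_sum_Ico_succ_bot (by omega), gaussSum', ← Finset.Ico_add_one_right_eq_Icc,
    Finset.sum_Ico_succ_top hq.le]
  simp only [ZMod.natCast_self, Nat.cast_zero, h0, zero_mul, add_zero, zero_add]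
  refine Finset.sum_congr rfl fun j _ => ?_
  rw [← Int.cast_natCast j, ZMod.stdAddChar_coe]
  push_cast
  rfl

/-- The discrete Fourier transform of a primitive real character is a multiple of it. -/
theorem sum_char_mul_exp_eq {q : ℕ} (hq : 1 < q) {χ : DirichletCharacter ℂ q}
    (hprim : χ.IsPrimitive) (hreal : ∀ x : ZMod q, (χ x).im = 0) (k : ℤ) :
    ∑ j ∈ Finset.Ico 1 q,
        χ (j : ZMod q) * Complex.exp (2 * Real.pi * Complex.I * (k * j : ℤ) / q) =
      χ (k : ZMod q) * gaussSum' χ := by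
  have : NeZero q := ⟨by omega⟩
  have h0 : χ (0 : ZMod q) = 0 := χ.apply_zero_of_one_lt hq
  have h := gaussSum_mulShift_of_isPrimitive ZMod.stdAddChar hprim (k : ZMod q)
  rw [χ.inv_eq_self_of_im_eq_zero hreal, ← gaussSum'_eq_gaussSum hq, gaussSum,
    ← ZMod.sum_range_natCast, Finset.range_eq_Ico,
    Finset.sum_eq_sum_Ico_succ_bot (by omega)] at h
  rw [← h]
  simp only [Nat.cast_zero, h0, zero_mul, zero_add]
  refine Finset.sum_congr rfl fun j _ => ?_
  rw [AddChar.mulShift_apply, ← Int.cast_natCast j, ← Int.cast_mul, ZMod.stdAddChar_coe]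

/-- The superposition of heat kernels translated by multiples of `c * n`, weighted by a primitive
real character, in terms of its Fourier coefficients. -/
theorem sum_char_mul_heatKernel {q : ℕ} (hq : 1 < q) {χ : DirichletCharacter ℂ q}
    (hprim : χ.IsPrimitive) (hreal : ∀ x : ZMod q, (χ x).im = 0) {c : ℤ}
    (hc : χ (c : ZMod q) = 1) {n : ℕ} (hn : 1 ≤ n) (t : ℝ) (x : ℤ) :
    ∑ j ∈ Finset.Ico 1 q, χ (j : ZMod q) * heatKernel q n t (x + c * (j * n)) =
      (gaussSum' χ / (q * n : ℂ)) * ∑ ω ∈ Finset.Ico 1 (q * n),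
        χ (ω : ZMod q) * (Real.exp (-(4 * t * Real.sin (Real.pi * ω / (q * n)) ^ 2)) : ℂ) *
          Complex.exp (2 * Real.pi * Complex.I * x * ω / (q * n)) := by
  have hq0 : (q : ℂ) ≠ 0 := Nat.cast_ne_zero.mpr (by omega)
  have hn0 : (n : ℂ) ≠ 0 := Nat.cast_ne_zero.mpr (by omega)
  have h0 : χ (0 : ZMod q) = 0 := χ.apply_zero_of_one_lt hq
  have hpos : 0 < q * n := by positivity
  have hω : ∀ ω : ℕ, ∑ j ∈ Finset.Ico 1 q, χ (j : ZMod q) *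
      Complex.exp (2 * Real.pi * Complex.I * (x + c * (j * n) : ℤ) * ω / (q * n)) =
      χ (ω : ZMod q) * gaussSum' χ *
        Complex.exp (2 * Real.pi * Complex.I * x * ω / (q * n)) := by
    intro ω
    have h := sum_char_mul_exp_eq hq hprim hreal (c * ω)
    rw [Int.cast_mul, map_mul, hc, one_mul, Int.cast_natCast] at h
    rw [← h, Finset.sum_mul]
    refine Finset.sum_congr rfl fun j _ => ?_
    rw [mul_assoc (χ (j : ZMod q)), ← Complex.exp_add]
    congr 2
    push_cast
    field_simp
    ring
  simp only [heatKernel, Finset.mul_sum]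
  rw [Finset.sum_comm, Finset.range_eq_Ico, Finset.sum_eq_sum_Ico_succ_bot hpos]
  have key : ∀ ω : ℕ, ∑ j ∈ Finset.Ico 1 q, χ (j : ZMod q) * (1 / (q * n : ℂ) *
      ((Real.exp (-(4 * t * Real.sin (Real.pi * ω / (q * n)) ^ 2)) : ℂ) *
        Complex.exp (2 * Real.pi * Complex.I * (x + c * (j * n) : ℤ) * ω / (q * n)))) =
      gaussSum' χ / (q * n : ℂ) * (χ (ω : ZMod q) *
        (Real.exp (-(4 * t * Real.sin (Real.pi * ω / (q * n)) ^ 2)) : ℂ) *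
          Complex.exp (2 * Real.pi * Complex.I * x * ω / (q * n))) := by
    intro ω
    trans (1 / (q * n : ℂ) *
      (Real.exp (-(4 * t * Real.sin (Real.pi * ω / (q * n)) ^ 2)) : ℂ)) *
      ∑ j ∈ Finset.Ico 1 q, χ (j : ZMod q) *
      Complex.exp (2 * Real.pi * Complex.I * (x + c * (j * n) : ℤ) * ω / (q * n))
    · rw [Finset.mul_sum]
      exact Finset.sum_congr rfl fun j _ => by ring
    · rw [hω]
      ring
  rw [key 0, Nat.cast_zero, h0, zero_mul, zero_mul, mul_zero, zero_add]
  exact Finset.sum_congr rfl fun ω _ => key ω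

theorem heat_solution_two_expressions {q : ℕ} (hq : 1 < q)
    (χ : DirichletCharacter ℂ q) (hprim : χ.IsPrimitive) (hχ : χ (-1) = 1)
    (hreal : ∀ x : ZMod q, (χ x).im = 0)
    (n : ℕ) (hn : 1 ≤ n) (t : ℝ) (x : ℤ) :
    ((gaussSum' χ / (q * n : ℂ)) *
        ∑ ω ∈ Finset.Ico 1 (q * n),
          χ (ω : ZMod q) * (Real.exp (-(4 * t * Real.sin (Real.pi * ω / (q * n)) ^ 2)) : ℂ) *
            Complex.exp (2 * Real.pi * Complex.I * x * ω / (q * n)) =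
      ∑ j ∈ Finset.Ico 1 q, χ (j : ZMod q) * heatKernel q n t (x - j * n)) ∧
    (gaussSum' χ *
        ∑ j ∈ Finset.Ico 1 (q * n),
          χ (j : ZMod q) * (Real.exp (-(4 * t * Real.sin (Real.pi * j / (q * n)) ^ 2)) : ℂ) =
      (q * n : ℂ) * ∑ j ∈ Finset.Ico 1 q, χ (j : ZMod q) * heatKernel q n t (j * n)) := by
  have hq0 : (q : ℂ) ≠ 0 := Nat.cast_ne_zero.mpr (by omega)
  have hn0 : (n : ℂ) ≠ 0 := Nat.cast_ne_zero.mpr (by omega)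
  constructor
  · have hc : χ ((-1 : ℤ) : ZMod q) = 1 := by simpa using hχ
    rw [← sum_char_mul_heatKernel hq hprim hreal hc hn]
    simp only [neg_one_mul, sub_eq_add_neg]
  · have hc : χ ((1 : ℤ) : ZMod q) = 1 := by simp
    have h := sum_char_mul_heatKernel hq hprim hreal hc hn t 0
    simp only [one_mul, zero_add, Int.cast_zero, mul_zero, zero_mul, zero_div, Complex.exp_zero,
      mul_one] at h
    rw [h]
    field_simp
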